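/- arXiv:2210.03511 — 3 statements merged into one kernel-verified Lean document; each statement's English description precedes it below -/
import Mathlib

section
/- (Marshall–Lieb–Mattis theorem, spin-1/2 case.) Let G = (V, E) be a finite connected simple bipartite graph with bipartition V = A ∪ B satisfying |A| = |B|, and let H = Σ_{{i,j}∈E} J_{ij} S_i·S_j be the antiferromagnetic spin-1/2 Heisenberg Hamiltonian with J_{ij} > 0 for every edge {i,j}. Then the minimum eigenvalue of H is nondegenerate (its eigenspace is one-dimensional) and the corresponding ground state ψ₀ satisfies S²_tot ψ₀ = 0, i.e., the ground state has total spin zero. -/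
/-- The Pauli matrices `σˣ, σʸ, σᶻ`. -/
noncomputable def pauli : Fin 3 → Matrix (Fin 2) (Fin 2) ℂ
  | 0 => !![0, 1; 1, 0]
  | 1 => !![0, -Complex.I; Complex.I, 0]
  | 2 => !![1, 0; 0, -1]

/-- The local spin-1/2 operator `S_i^α` on `N` sites: it acts as
`(1/2)σ^α` on the tensor factor at site `i` and as the identity elsewhere.
The `2^N`-dimensional Hilbert space is realized as functions
`(Fin N → Fin 2) → ℂ`, with `0 = ↑` and `1 = ↓`. -/
noncomputable def spinOp {N : ℕ} (i : Fin N) (α : Fin 3) :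
    Matrix (Fin N → Fin 2) (Fin N → Fin 2) ℂ :=
  Matrix.of fun σ τ =>
    (1 / 2 : ℂ) * pauli α (σ i) (τ i) *
      ∏ j ∈ Finset.univ.erase i, (if σ j = τ j then (1 : ℂ) else 0)

/-- The Heisenberg interaction `S_i·S_j = Σ_α S_i^α S_j^α`. -/
noncomputable def heis {N : ℕ} (i j : Fin N) :
    Matrix (Fin N → Fin 2) (Fin N → Fin 2) ℂ :=
  ∑ α : Fin 3, spinOp i α * spinOp j α

/-- The fully polarized state `|↑↑…↑⟩`. -/
noncomputable def allUp {N : ℕ} : (Fin N → Fin 2) → ℂ :=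
  fun σ => if σ = fun _ => 0 then 1 else 0
open Matrix

namespace MLM

abbrev Cfg (N : ℕ) := Fin N → Fin 2

/-- Embedding of a one-site operator at site `i`. -/
noncomputable def emb {N : ℕ} (i : Fin N) (a : Matrix (Fin 2) (Fin 2) ℂ) :
    Matrix (Cfg N) (Cfg N) ℂ :=
  Matrix.of fun σ τ => a (σ i) (τ i) *
      ∏ j ∈ Finset.univ.erase i, (if σ j = τ j then (1 : ℂ) else 0)

lemma emb_mulVec {N : ℕ} (i : Fin N) (a : Matrix (Fin 2) (Fin 2) ℂ) (ψ : Cfg N → ℂ)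
    (σ : Cfg N) :
    (emb i a *ᵥ ψ) σ = ∑ x, a (σ i) x * ψ (Function.update σ i x) := by
  classical
  simp only [mulVec, dotProduct, emb, Matrix.of_apply]
  symm
  apply Finset.sum_of_injOn (fun x => Function.update σ i x)
  · intro x _ y _ h
    have := congrFun h i
    simpa using this
  · simp
  · intro τ _ hτ
    have : ∃ j ∈ Finset.univ.erase i, σ j ≠ τ j := by
      by_contra hc
      push Not at hc
      apply hτ
      simp only [Finset.coe_univ, Set.image_univ, Set.mem_range]
      refine ⟨τ i, ?_⟩
      ext1 j
      by_cases hj : j = i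
      · subst hj; simp
      · simp [hj, hc j (by simp [hj])]
    obtain ⟨j, hj, hne⟩ := this
    rw [Finset.prod_eq_zero hj (by simp [hne])]
    simp
  · intro x _
    rw [Finset.prod_eq_one]
    · simp
    · intro j hj
      have : j ≠ i := by simpa using hj
      simp [this]

lemma spinOp_eq {N : ℕ} (i : Fin N) (α : Fin 3) :
    spinOp i α = emb i ((1 / 2 : ℂ) • pauli α) := by
  ext σ τ
  simp [spinOp, emb]

/-- Total operator. -/
noncomputable def tot {N : ℕ} (a : Matrix (Fin 2) (Fin 2) ℂ) :
    Matrix (Cfg N) (Cfg N) ℂ := ∑ i, emb i a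

lemma tot_mulVec {N : ℕ} (a : Matrix (Fin 2) (Fin 2) ℂ) (ψ : Cfg N → ℂ) (σ : Cfg N) :
    (tot a *ᵥ ψ) σ = ∑ i, ∑ x, a (σ i) x * ψ (Function.update σ i x) := by
  simp only [tot, Matrix.sum_mulVec, Finset.sum_apply, emb_mulVec]

lemma pauli_sum (a x b y : Fin 2) :
    ∑ α : Fin 3, pauli α a x * pauli α b y =
      2 * (if x = b ∧ y = a then 1 else 0) - (if x = a ∧ y = b then (1 : ℂ) else 0) := by
  fin_cases a <;> fin_cases x <;> fin_cases b <;> fin_cases y <;>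
    simp [Fin.sum_univ_three, pauli] <;> norm_num

lemma heis_mulVec {N : ℕ} (i j : Fin N) (hij : i ≠ j) (ψ : Cfg N → ℂ) (σ : Cfg N) :
    (heis i j *ᵥ ψ) σ = 1 / 2 * ψ (σ ∘ Equiv.swap i j) - 1 / 4 * ψ σ := by
  have h1 : (heis i j *ᵥ ψ) σ = ∑ x, ∑ y, (1 / 4 : ℂ) *
      (∑ α : Fin 3, pauli α (σ i) x * pauli α (σ j) y) *
        ψ (Function.update (Function.update σ i x) j y) := by
    simp only [heis, Matrix.sum_mulVec, Finset.sum_apply, ← Matrix.mulVec_mulVec, spinOp_eq,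
      emb_mulVec, Function.update_of_ne hij.symm, Finset.mul_sum, Finset.sum_mul]
    rw [Finset.sum_comm]
    refine Finset.sum_congr rfl fun x _ => ?_
    rw [Finset.sum_comm]
    refine Finset.sum_congr rfl fun y _ => Finset.sum_congr rfl fun α _ => ?_
    simp only [Matrix.smul_apply, smul_eq_mul]
    ring
  rw [h1]
  simp only [pauli_sum]
  have h2 : σ ∘ Equiv.swap i j = Function.update (Function.update σ i (σ j)) j (σ i) := by
    rw [Equiv.swap_comm, Equiv.comp_swap_eq_update]
  have h3 : σ = Function.update (Function.update σ i (σ i)) j (σ j) := by simp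
  have e : ∀ x y : Fin 2, (1 / 4 : ℂ) * (2 * (if x = σ j ∧ y = σ i then 1 else 0)
      - (if x = σ i ∧ y = σ j then (1 : ℂ) else 0)) *
        ψ (Function.update (Function.update σ i x) j y)
      = (if x = σ j then (if y = σ i then 1 / 2 * ψ (Function.update (Function.update σ i x) j y) else 0) else 0)
       - (if x = σ i then (if y = σ j then 1 / 4 * ψ (Function.update (Function.update σ i x) j y) else 0) else 0) := by
    intro x y
    clear h1 h2 h3
    simp only [ite_and]
    split_ifs <;> ring
  simp only [e, Finset.sum_sub_distrib]
  simp [h2]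

lemma emb_mul_self {N : ℕ} (i : Fin N) (a b : Matrix (Fin 2) (Fin 2) ℂ) :
    emb i a * emb i b = emb i (a * b) := by
  apply Matrix.mulVec_injective
  ext ψ σ
  rw [← Matrix.mulVec_mulVec]
  simp only [emb_mulVec, Function.update_self, Function.update_idem, Matrix.mul_apply,
    Finset.mul_sum, Finset.sum_mul]
  rw [Finset.sum_comm]
  simp only [mul_assoc]

lemma emb_comm {N : ℕ} (i j : Fin N) (hij : i ≠ j) (a b : Matrix (Fin 2) (Fin 2) ℂ) :
    emb i a * emb j b = emb j b * emb i a := by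
  apply Matrix.mulVec_injective
  ext ψ σ
  rw [← Matrix.mulVec_mulVec, ← Matrix.mulVec_mulVec]
  simp only [emb_mulVec, Function.update_of_ne hij, Function.update_of_ne hij.symm,
    Finset.mul_sum]
  rw [Finset.sum_comm]
  refine Finset.sum_congr rfl fun x _ => Finset.sum_congr rfl fun y _ => ?_
  rw [Function.update_comm hij]
  ring

lemma emb_sub {N : ℕ} (i : Fin N) (a b : Matrix (Fin 2) (Fin 2) ℂ) :
    emb i (a - b) = emb i a - emb i b := by
  ext σ τ; simp [emb, sub_mul]

lemma emb_add {N : ℕ} (i : Fin N) (a b : Matrix (Fin 2) (Fin 2) ℂ) :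
    emb i (a + b) = emb i a + emb i b := by
  ext σ τ; simp [emb, add_mul]

lemma emb_smul {N : ℕ} (i : Fin N) (c : ℂ) (a : Matrix (Fin 2) (Fin 2) ℂ) :
    emb i (c • a) = c • emb i a := by
  ext σ τ; simp [emb, mul_assoc]

lemma tot_comm {N : ℕ} (a b : Matrix (Fin 2) (Fin 2) ℂ) :
    (tot a * tot b - tot b * tot a : Matrix (Cfg N) (Cfg N) ℂ) = tot (a * b - b * a) := by
  simp only [tot, Finset.sum_mul_sum]
  rw [Finset.sum_comm (f := fun i j => emb i b * emb j a)]
  rw [← Finset.sum_sub_distrib]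
  refine Finset.sum_congr rfl fun i _ => ?_
  rw [← Finset.sum_sub_distrib, Finset.sum_eq_single i]
  · rw [emb_mul_self, emb_mul_self, emb_sub]
  · intro j _ hj
    rw [emb_comm i j hj.symm, sub_self]
  · simp

lemma emb_conjTranspose {N : ℕ} (i : Fin N) (a : Matrix (Fin 2) (Fin 2) ℂ) :
    (emb i a)ᴴ = emb i aᴴ := by
  ext σ τ
  simp only [emb, Matrix.conjTranspose_apply, Matrix.of_apply, star_mul', star_prod]
  congr 1
  refine Finset.prod_congr rfl fun j _ => ?_
  by_cases h : σ j = τ j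
  · simp [h]
  · simp [h, Ne.symm h]

lemma tot_conjTranspose {N : ℕ} (a : Matrix (Fin 2) (Fin 2) ℂ) :
    (tot a : Matrix (Cfg N) (Cfg N) ℂ)ᴴ = tot aᴴ := by
  simp [tot, Matrix.conjTranspose_sum, emb_conjTranspose]

/-- total operators commute with site permutations -/
lemma tot_perm {N : ℕ} (a : Matrix (Fin 2) (Fin 2) ℂ) (π : Equiv.Perm (Fin N)) (ψ : Cfg N → ℂ)
    (σ : Cfg N) : (tot a *ᵥ (fun τ => ψ (τ ∘ π))) σ = (tot a *ᵥ ψ) (σ ∘ π) := by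
  rw [tot_mulVec, tot_mulVec, ← Equiv.sum_comp π]
  refine Finset.sum_congr rfl fun i _ => Finset.sum_congr rfl fun x _ => ?_
  simp only [Function.comp_apply]
  congr 2
  have := Function.update_comp_eq_of_injective σ π.injective i x
  exact this

/-- raising operator -/
noncomputable def Rop {N : ℕ} : Matrix (Cfg N) (Cfg N) ℂ := tot !![0, 1; 0, 0]
/-- lowering operator -/
noncomputable def Lop {N : ℕ} : Matrix (Cfg N) (Cfg N) ℂ := tot !![0, 0; 1, 0]

lemma Rop_conjTranspose {N : ℕ} : (Rop : Matrix (Cfg N) (Cfg N) ℂ)ᴴ = Lop := by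
  rw [Rop, Lop, tot_conjTranspose]
  congr 1
  ext i j
  fin_cases i <;> fin_cases j <;> simp

lemma Lop_conjTranspose {N : ℕ} : (Lop : Matrix (Cfg N) (Cfg N) ℂ)ᴴ = Rop := by
  rw [← Rop_conjTranspose, Matrix.conjTranspose_conjTranspose]

/-- number of down spins -/
def wt {N : ℕ} (σ : Cfg N) : ℕ := (Finset.univ.filter (fun i => σ i = 1)).card

lemma tot_z {N : ℕ} (ψ : Cfg N → ℂ) (σ : Cfg N) :
    (tot !![1, 0; 0, -1] *ᵥ ψ) σ = ((N : ℂ) - 2 * wt σ) * ψ σ := by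
  rw [tot_mulVec]
  have : ∀ i, ∑ x, !![1, 0; 0, (-1 : ℂ)] (σ i) x * ψ (Function.update σ i x)
      = (1 - 2 * (if σ i = 1 then 1 else 0)) * ψ σ := by
    intro i
    have h3 : σ = Function.update σ i (σ i) := by simp
    have : σ i = 0 ∨ σ i = 1 := by omega
    rcases this with h | h
    · rw [h] at h3
      rw [h, Fin.sum_univ_two, ← h3]; simp
    · rw [h] at h3
      rw [h, Fin.sum_univ_two, ← h3]; simp; ring
  simp only [this, ← Finset.sum_mul]
  congr 1
  rw [Finset.sum_sub_distrib, ← Finset.mul_sum, Finset.sum_boole]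
  simp [wt]

lemma RL_comm {N : ℕ} (ψ : Cfg N → ℂ) (σ : Cfg N) :
    (Rop *ᵥ (Lop *ᵥ ψ)) σ = (Lop *ᵥ (Rop *ᵥ ψ)) σ + ((N : ℂ) - 2 * wt σ) * ψ σ := by
  rw [← tot_z]
  have := tot_comm (N := N) !![0, 1; 0, 0] !![0, 0; 1, 0]
  have h2 : (!![0, 1; 0, 0] * !![0, 0; 1, 0] - !![0, 0; 1, 0] * !![0, 1; 0, 0] :
      Matrix (Fin 2) (Fin 2) ℂ) = !![1, 0; 0, -1] := by
    ext i j
    fin_cases i <;> fin_cases j <;> simp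
  rw [h2] at this
  rw [← this, Matrix.sub_mulVec, ← Matrix.mulVec_mulVec, ← Matrix.mulVec_mulVec]
  simp [Rop, Lop]

lemma Rop_apply {N : ℕ} (ψ : Cfg N → ℂ) (σ : Cfg N) :
    (Rop *ᵥ ψ) σ = ∑ i, if σ i = 0 then ψ (Function.update σ i 1) else 0 := by
  rw [Rop, tot_mulVec]
  refine Finset.sum_congr rfl fun i _ => ?_
  have : σ i = 0 ∨ σ i = 1 := by omega
  rcases this with h | h <;> simp [h]

lemma Lop_apply {N : ℕ} (ψ : Cfg N → ℂ) (σ : Cfg N) :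
    (Lop *ᵥ ψ) σ = ∑ i, if σ i = 1 then ψ (Function.update σ i 0) else 0 := by
  rw [Lop, tot_mulVec]
  refine Finset.sum_congr rfl fun i _ => ?_
  have : σ i = 0 ∨ σ i = 1 := by omega
  rcases this with h | h <;> simp [h]

/-- supported on `k` down spins -/
def InSec {N : ℕ} (k : ℕ) (ψ : Cfg N → ℂ) : Prop := ∀ σ, ψ σ ≠ 0 → wt σ = k

lemma wt_update_one {N : ℕ} (σ : Cfg N) (i : Fin N) (h : σ i = 0) :
    wt (Function.update σ i 1) = wt σ + 1 := by
  have : (Finset.univ.filter (fun j => Function.update σ i 1 j = 1))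
      = insert i (Finset.univ.filter (fun j => σ j = 1)) := by
    ext j
    by_cases hj : j = i
    · subst hj; simp
    · simp [hj]
  rw [wt, this, Finset.card_insert_of_notMem (by simp [h]), wt]

lemma wt_update_zero {N : ℕ} (σ : Cfg N) (i : Fin N) (h : σ i = 1) :
    wt (Function.update σ i 0) + 1 = wt σ := by
  rw [← wt_update_one _ i (by simp)]
  congr 1
  rw [Function.update_idem, ← h, Function.update_eq_self]

lemma Rop_sec {N : ℕ} {k : ℕ} {ψ : Cfg N → ℂ} (h : InSec (k + 1) ψ) : InSec k (Rop *ᵥ ψ) := by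
  intro σ hσ
  rw [Rop_apply] at hσ
  obtain ⟨i, _, hi⟩ := Finset.exists_ne_zero_of_sum_ne_zero hσ
  split_ifs at hi with h0
  · have := h _ hi
    rw [wt_update_one _ _ h0] at this
    omega
  · exact absurd rfl hi

lemma Lop_sec {N : ℕ} {k : ℕ} {ψ : Cfg N → ℂ} (h : InSec k ψ) : InSec (k + 1) (Lop *ᵥ ψ) := by
  intro σ hσ
  rw [Lop_apply] at hσ
  obtain ⟨i, _, hi⟩ := Finset.exists_ne_zero_of_sum_ne_zero hσ
  split_ifs at hi with h0
  · have := h _ hi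
    rw [← wt_update_zero _ _ h0, this]
  · exact absurd rfl hi

lemma wt_perm {N : ℕ} (σ : Cfg N) (π : Equiv.Perm (Fin N)) : wt (σ ∘ π) = wt σ := by
  apply Finset.card_bij (fun i _ => π i)
  · simp
  · simp
  · intro b hb
    exact ⟨π.symm b, by simpa using hb, by simp⟩

lemma exists_perm {N : ℕ} (σ τ : Cfg N) (h : wt σ = wt τ) :
    ∃ π : Equiv.Perm (Fin N), τ = σ ∘ π := by
  have hc : Fintype.card {i // τ i = 1} = Fintype.card {i // σ i = 1} := by
    rw [Fintype.card_subtype, Fintype.card_subtype]; exact h.symm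
  obtain ⟨e⟩ := Fintype.card_eq.mp hc
  refine ⟨e.extendSubtype, ?_⟩
  ext1 i
  by_cases hi : τ i = 1
  · have := e.extendSubtype_mem i hi
    simp [hi, this]
  · have := e.extendSubtype_not_mem i hi
    simp only [Function.comp_apply]
    omega

end MLM

namespace MLM

/-- Hamiltonian -/
noncomputable def Ham {N : ℕ} (E : Finset (Fin N × Fin N)) (J : Fin N → Fin N → ℝ) :
    Matrix (Cfg N) (Cfg N) ℂ := ∑ p ∈ E, (J p.1 p.2 : ℂ) • heis p.1 p.2

lemma Ham_mulVec {N : ℕ} {E : Finset (Fin N × Fin N)} (J : Fin N → Fin N → ℝ)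
    (hE : ∀ p ∈ E, p.1 ≠ p.2) (ψ : Cfg N → ℂ) :
    Ham E J *ᵥ ψ = ∑ p ∈ E, (J p.1 p.2 : ℂ) •
      ((1 / 2 : ℂ) • (fun τ : Cfg N => ψ (τ ∘ Equiv.swap p.1 p.2)) - (1 / 4 : ℂ) • ψ) := by
  rw [Ham, Matrix.sum_mulVec]
  refine Finset.sum_congr rfl fun p hp => ?_
  rw [Matrix.smul_mulVec]
  congr 1
  ext σ
  rw [heis_mulVec _ _ (hE p hp)]
  simp

lemma Ham_apply {N : ℕ} {E : Finset (Fin N × Fin N)} (J : Fin N → Fin N → ℝ)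
    (hE : ∀ p ∈ E, p.1 ≠ p.2) (ψ : Cfg N → ℂ) (σ : Cfg N) :
    (Ham E J *ᵥ ψ) σ = ∑ p ∈ E, (J p.1 p.2 : ℂ) *
      ((1 / 2 : ℂ) * ψ (σ ∘ Equiv.swap p.1 p.2) - (1 / 4 : ℂ) * ψ σ) := by
  rw [Ham_mulVec J hE]
  simp

lemma Ham_tot {N : ℕ} {E : Finset (Fin N × Fin N)} (J : Fin N → Fin N → ℝ)
    (hE : ∀ p ∈ E, p.1 ≠ p.2) (a : Matrix (Fin 2) (Fin 2) ℂ) (ψ : Cfg N → ℂ) :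
    Ham E J *ᵥ (tot a *ᵥ ψ) = tot a *ᵥ (Ham E J *ᵥ ψ) := by
  rw [Ham_mulVec J hE, Ham_mulVec J hE, Matrix.mulVec_sum]
  refine Finset.sum_congr rfl fun p hp => ?_
  rw [Matrix.mulVec_smul, Matrix.mulVec_sub, Matrix.mulVec_smul, Matrix.mulVec_smul]
  congr 3
  ext σ
  rw [tot_perm]

lemma pauli_herm (α : Fin 3) : (pauli α)ᴴ = pauli α := by
  ext i j
  fin_cases α <;> fin_cases i <;> fin_cases j <;> simp [pauli]

lemma heis_herm {N : ℕ} (i j : Fin N) (hij : i ≠ j) : (heis i j)ᴴ = heis i j := by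
  rw [heis, Matrix.conjTranspose_sum]
  refine Finset.sum_congr rfl fun α _ => ?_
  rw [Matrix.conjTranspose_mul, spinOp_eq, spinOp_eq, emb_conjTranspose, emb_conjTranspose,
    Matrix.conjTranspose_smul, pauli_herm, emb_comm j i hij.symm]
  simp

lemma Ham_herm {N : ℕ} {E : Finset (Fin N × Fin N)} (J : Fin N → Fin N → ℝ)
    (hE : ∀ p ∈ E, p.1 ≠ p.2) : (Ham E J).IsHermitian := by
  rw [Matrix.IsHermitian, Ham, Matrix.conjTranspose_sum]
  refine Finset.sum_congr rfl fun p hp => ?_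
  rw [Matrix.conjTranspose_smul, heis_herm _ _ (hE p hp)]
  simp

/-- sector projection -/
noncomputable def proj {N : ℕ} (k : ℕ) (ψ : Cfg N → ℂ) : Cfg N → ℂ :=
  fun σ => if wt σ = k then ψ σ else 0

lemma proj_sec {N : ℕ} (k : ℕ) (ψ : Cfg N → ℂ) : InSec k (proj k ψ) := by
  intro σ h
  by_contra hc
  simp [proj, hc] at h

lemma Ham_proj {N : ℕ} {E : Finset (Fin N × Fin N)} (J : Fin N → Fin N → ℝ)
    (hE : ∀ p ∈ E, p.1 ≠ p.2) (k : ℕ) (ψ : Cfg N → ℂ) :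
    Ham E J *ᵥ (proj k ψ) = proj k (Ham E J *ᵥ ψ) := by
  ext σ
  rw [Ham_apply J hE]
  simp only [proj, wt_perm]
  split_ifs
  · rw [Ham_apply J hE]
  · simp

/-- Marshall sign -/
noncomputable def sgn {N : ℕ} (A : Finset (Fin N)) (σ : Cfg N) : ℝ :=
  ∏ i ∈ A, if σ i = 1 then (-1 : ℝ) else 1

lemma sgn_sq {N : ℕ} (A : Finset (Fin N)) (σ : Cfg N) : sgn A σ * sgn A σ = 1 := by
  rw [sgn, ← Finset.prod_mul_distrib]
  refine Finset.prod_eq_one fun i _ => ?_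
  split_ifs <;> simp

lemma sgn_update_not_mem {N : ℕ} (A : Finset (Fin N)) (σ : Cfg N) (i : Fin N) (hi : i ∉ A)
    (x : Fin 2) : sgn A (Function.update σ i x) = sgn A σ := by
  refine Finset.prod_congr rfl fun j hj => ?_
  have : j ≠ i := fun h => hi (h ▸ hj)
  rw [Function.update_of_ne this]

lemma sgn_update_mem {N : ℕ} (A : Finset (Fin N)) (σ : Cfg N) (i : Fin N) (hi : i ∈ A)
    (x : Fin 2) (hx : x ≠ σ i) : sgn A (Function.update σ i x) = - sgn A σ := by
  rw [sgn, sgn, ← Finset.mul_prod_erase _ _ hi, ← Finset.mul_prod_erase _ _ hi, ← neg_mul]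
  congr 1
  · rw [Function.update_self]
    have h1 : x = 0 ∨ x = 1 := by omega
    have h2 : σ i = 0 ∨ σ i = 1 := by omega
    rcases h1 with h1 | h1 <;> rcases h2 with h2 | h2 <;> simp_all
  · refine Finset.prod_congr rfl fun j hj => ?_
    rw [Function.update_of_ne (Finset.ne_of_mem_erase hj)]

lemma sgn_swap {N : ℕ} (A : Finset (Fin N)) (σ : Cfg N) (i j : Fin N) (h : i ∈ A ↔ j ∉ A)
    (hne : σ i ≠ σ j) : sgn A (σ ∘ Equiv.swap i j) = - sgn A σ := by
  by_cases hi : i ∈ A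
  · rw [Equiv.swap_comm, Equiv.comp_swap_eq_update, sgn_update_not_mem _ _ _ (h.1 hi),
      sgn_update_mem _ _ _ hi _ hne.symm]
  · rw [Equiv.comp_swap_eq_update, sgn_update_not_mem _ _ _ hi,
      sgn_update_mem _ _ _ (by tauto) _ hne]

lemma comp_swap_of_eq {N : ℕ} (σ : Cfg N) (i j : Fin N) (h : σ i = σ j) :
    σ ∘ Equiv.swap i j = σ := by
  rw [Equiv.comp_swap_eq_update, h, Function.update_eq_self, ← h, Function.update_eq_self]

/-- Marshall-positive version of a vector. -/
noncomputable def mar {N : ℕ} (A : Finset (Fin N)) (ψ : Cfg N → ℂ) : Cfg N → ℂ :=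
  fun σ => ((sgn A σ * ‖ψ σ‖ : ℝ) : ℂ)

lemma mar_eq_zero {N : ℕ} (A : Finset (Fin N)) (ψ : Cfg N → ℂ) (σ : Cfg N) :
    mar A ψ σ = 0 ↔ ψ σ = 0 := by
  have := sgn_sq A σ
  have : sgn A σ ≠ 0 := by intro h; simp [h] at this
  simp [mar, this]

lemma norm_mar {N : ℕ} (A : Finset (Fin N)) (ψ : Cfg N → ℂ) (σ : Cfg N) :
    star (mar A ψ σ) * mar A ψ σ = star (ψ σ) * ψ σ := by
  have h := sgn_sq A σ
  have h2 : star (ψ σ) * ψ σ = ((‖ψ σ‖ * ‖ψ σ‖ : ℝ) : ℂ) := by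
    rw [← sq, ← Complex.normSq_eq_norm_sq, Complex.normSq_eq_conj_mul_self]; rfl
  rw [h2, mar]
  have : star ((sgn A σ * ‖ψ σ‖ : ℝ) : ℂ) = ((sgn A σ * ‖ψ σ‖ : ℝ) : ℂ) := Complex.conj_ofReal _
  rw [this, ← Complex.ofReal_mul]
  congr 1
  linear_combination ‖ψ σ‖ * ‖ψ σ‖ * h

open scoped ComplexOrder

section PF

variable {N : ℕ} {E : Finset (Fin N × Fin N)} {J : Fin N → Fin N → ℝ} {A : Finset (Fin N)}
  {E₀ : ℝ}

lemma mar_energy (hE : ∀ p ∈ E, p.1 ≠ p.2) (hA : ∀ p ∈ E, (p.1 ∈ A ↔ p.2 ∉ A))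
    (hJ : ∀ p ∈ E, 0 < J p.1 p.2) (ψ : Cfg N → ℂ) :
    (star (mar A ψ) ⬝ᵥ (Ham E J *ᵥ mar A ψ)).re ≤ (star ψ ⬝ᵥ (Ham E J *ᵥ ψ)).re := by
  simp only [dotProduct, Ham_apply J hE, Pi.star_apply, Complex.re_sum, Finset.mul_sum]
  refine Finset.sum_le_sum fun σ _ => Finset.sum_le_sum fun p hp => ?_
  have key : (star (mar A ψ σ) * mar A ψ (σ ∘ Equiv.swap p.1 p.2)).re ≤
      (star (ψ σ) * ψ (σ ∘ Equiv.swap p.1 p.2)).re := by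
    by_cases h : σ p.1 = σ p.2
    · rw [comp_swap_of_eq _ _ _ h, norm_mar]
    · have h1 : (star (mar A ψ σ) * mar A ψ (σ ∘ Equiv.swap p.1 p.2)).re
          = - (‖ψ σ‖ * ‖ψ (σ ∘ Equiv.swap p.1 p.2)‖) := by
        have hs := sgn_sq A σ
        have : star (mar A ψ σ) = mar A ψ σ := Complex.conj_ofReal _
        rw [this, mar, mar, sgn_swap A σ _ _ (hA p hp) h, ← Complex.ofReal_mul,
          Complex.ofReal_re]
        linear_combination - (‖ψ σ‖ * ‖ψ (σ ∘ Equiv.swap p.1 p.2)‖) * hs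
      rw [h1]
      have := Complex.abs_re_le_norm (star (ψ σ) * ψ (σ ∘ Equiv.swap p.1 p.2))
      rw [norm_mul, norm_star] at this
      exact (abs_le.1 this).1
  have e : ∀ φ : Cfg N → ℂ, (star (φ σ) * ((J p.1 p.2 : ℂ) *
      ((1 / 2 : ℂ) * φ (σ ∘ Equiv.swap p.1 p.2) - (1 / 4 : ℂ) * φ σ))).re =
      J p.1 p.2 * (1 / 2 * (star (φ σ) * φ (σ ∘ Equiv.swap p.1 p.2)).re
        - 1 / 4 * (star (φ σ) * φ σ).re) := by
    intro φ
    have : star (φ σ) * ((J p.1 p.2 : ℂ) *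
      ((1 / 2 : ℂ) * φ (σ ∘ Equiv.swap p.1 p.2) - (1 / 4 : ℂ) * φ σ)) =
      ((J p.1 p.2 * (1 / 2) : ℝ) : ℂ) * (star (φ σ) * φ (σ ∘ Equiv.swap p.1 p.2))
      - ((J p.1 p.2 * (1 / 4) : ℝ) : ℂ) * (star (φ σ) * φ σ) := by
      push_cast; ring
    rw [this, Complex.sub_re, Complex.re_ofReal_mul, Complex.re_ofReal_mul]
    ring
  rw [e, e, norm_mar]
  have := hJ p hp
  gcongr

lemma mar_eig (hE : ∀ p ∈ E, p.1 ≠ p.2) (hA : ∀ p ∈ E, (p.1 ∈ A ↔ p.2 ∉ A))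
    (hJ : ∀ p ∈ E, 0 < J p.1 p.2)
    (hpsd : (Ham E J - (E₀ : ℂ) • (1 : Matrix (Cfg N) (Cfg N) ℂ)).PosSemidef)
    (ψ : Cfg N → ℂ) (hψ : Ham E J *ᵥ ψ = (E₀ : ℂ) • ψ) :
    Ham E J *ᵥ mar A ψ = (E₀ : ℂ) • mar A ψ := by
  have hm := mar_energy hE hA hJ ψ
  have hn : star (mar A ψ) ⬝ᵥ mar A ψ = star ψ ⬝ᵥ ψ := by
    simp only [dotProduct, Pi.star_apply, norm_mar]
  have h0 : star (mar A ψ) ⬝ᵥ ((Ham E J - (E₀ : ℂ) • (1 : Matrix (Cfg N) (Cfg N) ℂ)) *ᵥ mar A ψ)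
      = 0 := by
    have h1 := hpsd.dotProduct_mulVec_nonneg (mar A ψ)
    refine le_antisymm ?_ h1
    rw [Complex.le_def] at h1 ⊢
    refine ⟨?_, h1.2.symm⟩
    rw [Matrix.sub_mulVec, Matrix.smul_mulVec, Matrix.one_mulVec, dotProduct_sub,
      dotProduct_smul, hn, Complex.sub_re]
    rw [hψ, dotProduct_smul] at hm
    simp only [Complex.zero_re]
    linarith
  rw [hpsd.dotProduct_mulVec_zero_iff, Matrix.sub_mulVec, Matrix.smul_mulVec,
    Matrix.one_mulVec, sub_eq_zero] at h0
  exact h0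

lemma zero_step (hE : ∀ p ∈ E, p.1 ≠ p.2) (hA : ∀ p ∈ E, (p.1 ∈ A ↔ p.2 ∉ A))
    (hJ : ∀ p ∈ E, 0 < J p.1 p.2)
    (hpsd : (Ham E J - (E₀ : ℂ) • (1 : Matrix (Cfg N) (Cfg N) ℂ)).PosSemidef)
    (ψ : Cfg N → ℂ) (hψ : Ham E J *ᵥ ψ = (E₀ : ℂ) • ψ) (σ : Cfg N) (h0 : ψ σ = 0)
    (p : Fin N × Fin N) (hp : p ∈ E) : ψ (σ ∘ Equiv.swap p.1 p.2) = 0 := by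
  have h := congrFun (mar_eig hE hA hJ hpsd ψ hψ) σ
  have hm0 : mar A ψ σ = 0 := (mar_eq_zero A ψ σ).2 h0
  rw [Ham_apply J hE, Pi.smul_apply, hm0, smul_zero] at h
  have h2 : ∑ p ∈ E, J p.1 p.2 * ‖ψ (σ ∘ Equiv.swap p.1 p.2)‖ = 0 := by
    have h3 : ((∑ p ∈ E, J p.1 p.2 * ‖ψ (σ ∘ Equiv.swap p.1 p.2)‖ : ℝ) : ℂ) =
        (-2 * sgn A σ : ℂ) * 0 := by
      rw [← h, Finset.mul_sum]
      push_cast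
      refine Finset.sum_congr rfl fun p hp => ?_
      by_cases hc : σ p.1 = σ p.2
      · rw [comp_swap_of_eq _ _ _ hc, hm0, h0]; simp
      · have hs : (sgn A σ : ℂ) * sgn A σ = 1 := by exact_mod_cast sgn_sq A σ
        rw [mar, sgn_swap A σ _ _ (hA p hp) hc]
        push_cast
        linear_combination (- (J p.1 p.2 : ℂ) * ‖ψ (σ ∘ Equiv.swap p.1 p.2)‖) * hs
    rw [mul_zero] at h3
    exact_mod_cast h3
  rw [Finset.sum_eq_zero_iff_of_nonneg] at h2
  · have := h2 p hp
    have hj := (hJ p hp).ne'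
    simpa [hj] using this
  · intro q hq
    have := hJ q hq
    positivity

lemma zero_perm (G : SimpleGraph (Fin N)) (hconn : G.Connected) (ψ : Cfg N → ℂ)
    (hs : ∀ i j, G.Adj i j → ∀ σ, ψ σ = 0 → ψ (σ ∘ Equiv.swap i j) = 0)
    (π : Equiv.Perm (Fin N)) (σ : Cfg N) (h0 : ψ σ = 0) : ψ (σ ∘ π) = 0 := by
  have hsw : ∀ i j, ∀ σ, ψ σ = 0 → ψ (σ ∘ Equiv.swap i j) = 0 := by
    intro i j
    obtain ⟨w⟩ := hconn.preconnected i j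
    induction w with
    | nil => intro σ h; simpa using h
    | @cons u v w huv _ ih =>
      intro σ h
      by_cases hvw : v = w
      · subst hvw; exact hs _ _ huv σ h
      by_cases huw : u = w
      · subst huw; simpa using h
      have e : Equiv.swap u w = Equiv.swap u v * Equiv.swap v w * Equiv.swap u v := by
        rw [← Equiv.swap_mul_swap_mul_swap (x := w) (y := v) (z := u) (Ne.symm hvw) (Ne.symm huw),
          Equiv.swap_comm v u, Equiv.swap_comm w v]
      rw [e]
      exact hs _ _ huv _ (ih _ (hs _ _ huv _ h))
  induction π using Equiv.Perm.swap_induction_on' generalizing σ with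
  | one => simpa using h0
  | mul_swap f x y _ ih =>
    exact hsw x y (σ ∘ f) (ih σ h0)

end PF

end MLM

namespace MLM

open scoped ComplexOrder

lemma exists_pairing {N : ℕ} (A : Finset (Fin N)) (h : A.card = Aᶜ.card) :
    ∃ t : Fin N → Fin N, (∀ i, t (t i) = i) ∧ ∀ i, (i ∈ A ↔ t i ∉ A) := by
  have hc : Fintype.card {i // i ∈ A} = Fintype.card {i // ¬ i ∈ A} := by
    rw [Fintype.card_coe, h, Fintype.card_subtype]
    congr 1
    ext i
    simp
  obtain ⟨e⟩ := Fintype.card_eq.mp hc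
  refine ⟨fun i => if hi : i ∈ A then (e ⟨i, hi⟩ : Fin N) else (e.symm ⟨i, hi⟩ : Fin N), ?_, ?_⟩
  · intro i
    by_cases hi : i ∈ A
    · have := (e ⟨i, hi⟩).2
      simp [hi, this]
    · have := (e.symm ⟨i, hi⟩).2
      simp [hi, this]
  · intro i
    by_cases hi : i ∈ A
    · have := (e ⟨i, hi⟩).2
      simp [hi, this]
    · have := (e.symm ⟨i, hi⟩).2
      simp [hi, this]

open Classical in
/-- dimer state -/
noncomputable def dim {N : ℕ} (A : Finset (Fin N)) (t : Fin N → Fin N) : Cfg N → ℂ :=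
  fun σ => if ∀ i, σ i ≠ σ (t i) then (sgn A σ : ℂ) else 0

section dimer
variable {N : ℕ} {A : Finset (Fin N)} {t : Fin N → Fin N}

lemma dim_swap (ht : ∀ i, t (t i) = i) (hA : ∀ i, (i ∈ A ↔ t i ∉ A)) (ρ : Cfg N) (i : Fin N)
    (hi : ρ i ≠ ρ (t i)) : dim A t (ρ ∘ Equiv.swap i (t i)) = - dim A t ρ := by
  have hc : ∀ k, t (Equiv.swap i (t i) k) = Equiv.swap i (t i) (t k) := by
    intro k
    by_cases h1 : k = i
    · subst h1; simp [ht]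
    by_cases h2 : k = t i
    · subst h2; simp [ht]
    have h3 : t k ≠ i := fun h => h2 (by rw [← h, ht])
    have h4 : t k ≠ t i := fun h => h1 (by rw [← ht k, h, ht])
    rw [Equiv.swap_apply_of_ne_of_ne h1 h2, Equiv.swap_apply_of_ne_of_ne h3 h4]
  have hiff : (∀ k, (ρ ∘ Equiv.swap i (t i)) k ≠ (ρ ∘ Equiv.swap i (t i)) (t k)) ↔
      ∀ k, ρ k ≠ ρ (t k) := by
    simp only [Function.comp_apply, ← hc]
    constructor
    · intro h k
      have := h (Equiv.swap i (t i) k)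
      simpa using this
    · intro h k
      exact h _
  unfold dim
  simp only [hiff, sgn_swap A ρ i (t i) (hA i) hi]
  split_ifs <;> simp

lemma R_dim (ht : ∀ i, t (t i) = i) (hA : ∀ i, (i ∈ A ↔ t i ∉ A)) :
    Rop *ᵥ dim A t = 0 := by
  have hne : ∀ i, t i ≠ i := by
    intro i h
    have := hA i
    rw [h] at this
    tauto
  ext σ
  rw [Rop_apply]
  have hz : ∀ i, σ (t i) = 1 → dim A t (Function.update σ i 1) = 0 := by
    intro i h
    unfold dim
    rw [if_neg]
    intro hc
    apply hc i
    simp [Function.update_of_ne (hne i), h]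
  apply Finset.sum_involution (fun i _ => t i)
  · intro i _
    have h1 : σ i = 0 ∨ σ i = 1 := by omega
    have h2 : σ (t i) = 0 ∨ σ (t i) = 1 := by omega
    rcases h1 with h1 | h1 <;> rcases h2 with h2 | h2
    · simp only [h1, h2, if_true]
      have h3 : Function.update σ (t i) 1 = Function.update σ i 1 ∘ Equiv.swap i (t i) := by
        rw [Equiv.comp_swap_eq_update]
        ext1 k
        by_cases hk : k = i
        · subst hk; simp [Function.update_of_ne (hne k), Function.update_of_ne (hne k).symm, h1, h2]
        · by_cases hk2 : k = t i
          · subst hk2; simp [hk]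
          · simp [hk, hk2]
      rw [h3, dim_swap ht hA]
      · simp
      · simp [Function.update_of_ne (hne i), h2]
    · simp [h1, h2, hz i h2]
    · have := hz (t i) (by rw [ht]; exact h1)
      simp [h1, h2, this]
    · simp [h1, h2]
  · intro i _ _
    exact hne i
  · simp
  · intro i _
    exact ht i

/-- Staggered configuration. -/
def stag {N : ℕ} (A : Finset (Fin N)) : Cfg N := fun i => if i ∈ A then 1 else 0

lemma wt_stag : wt (stag A) = A.card := by
  rw [wt]; congr 1; ext i; simp [stag]

lemma dim_mar_pos (hA : ∀ i, (i ∈ A ↔ t i ∉ A)) (ψ : Cfg N → ℂ) (h : ψ (stag A) ≠ 0) :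
    star (dim A t) ⬝ᵥ mar A ψ ≠ 0 := by
  classical
  have e : star (dim A t) ⬝ᵥ mar A ψ =
      ((∑ σ : Cfg N, if ∀ i, σ i ≠ σ (t i) then ‖ψ σ‖ else 0 : ℝ) : ℂ) := by
    rw [dotProduct, Complex.ofReal_sum]
    refine Finset.sum_congr rfl fun σ _ => ?_
    rw [Pi.star_apply]
    unfold dim mar
    split_ifs
    · have : star (sgn A σ : ℂ) = sgn A σ := Complex.conj_ofReal _
      rw [this, ← Complex.ofReal_mul, ← mul_assoc, sgn_sq, one_mul]
    · simp
  rw [e, Ne, Complex.ofReal_eq_zero, Finset.sum_eq_zero_iff_of_nonneg]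
  · intro hc
    have := hc (stag A) (Finset.mem_univ _)
    rw [if_pos] at this
    · exact h (by simpa using this)
    · intro i
      have := hA i
      by_cases hi : i ∈ A
      · have h2 := this.1 hi
        simp [stag, hi, h2]
      · have h2 : t i ∈ A := by tauto
        simp [stag, hi, h2]
  · intro σ _
    split_ifs <;> positivity

end dimer

lemma adj_dot {N : ℕ} (M : Matrix (Cfg N) (Cfg N) ℂ) (x y : Cfg N → ℂ) :
    star x ⬝ᵥ (M *ᵥ y) = star (Mᴴ *ᵥ x) ⬝ᵥ y := by
  rw [Matrix.star_mulVec, Matrix.conjTranspose_conjTranspose, Matrix.dotProduct_mulVec]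

lemma ker_of_neg {N : ℕ} (M : Matrix (Cfg N) (Cfg N) ℂ) (x : Cfg N → ℂ) (c : ℝ) (hc : c ≤ 0)
    (h : Mᴴ *ᵥ (M *ᵥ x) = (c : ℂ) • x) : M *ᵥ x = 0 ∧ (c < 0 → x = 0) := by
  have h1 : star (M *ᵥ x) ⬝ᵥ (M *ᵥ x) = (c : ℂ) * (star x ⬝ᵥ x) := by
    have := adj_dot Mᴴ x (M *ᵥ x)
    rw [h, Matrix.conjTranspose_conjTranspose, dotProduct_smul, smul_eq_mul] at this
    exact this.symm
  have h2 : 0 ≤ star (M *ᵥ x) ⬝ᵥ (M *ᵥ x) := dotProduct_star_self_nonneg _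
  have h3 : 0 ≤ star x ⬝ᵥ x := dotProduct_star_self_nonneg _
  have hc' : (c : ℂ) ≤ 0 := by exact_mod_cast hc
  have h4 : star (M *ᵥ x) ⬝ᵥ (M *ᵥ x) = 0 :=
    le_antisymm (h1 ▸ mul_nonpos_of_nonpos_of_nonneg hc' h3) h2
  refine ⟨dotProduct_star_self_eq_zero.1 h4, fun hlt => ?_⟩
  rw [h4] at h1
  have : (c : ℂ) ≠ 0 := by exact_mod_cast hlt.ne
  rcases mul_eq_zero.1 h1.symm with h5 | h5
  · exact absurd h5 this
  · exact dotProduct_star_self_eq_zero.1 h5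

lemma RL_sec {N : ℕ} {k : ℕ} {ψ : Cfg N → ℂ} (h : InSec k ψ) :
    Rop *ᵥ (Lop *ᵥ ψ) = Lop *ᵥ (Rop *ᵥ ψ) + ((N - 2 * k : ℝ) : ℂ) • ψ := by
  ext σ
  rw [RL_comm, Pi.add_apply, Pi.smul_apply, smul_eq_mul]
  by_cases h0 : ψ σ = 0
  · simp [h0]
  · rw [h σ h0]; push_cast; rfl

section main
variable {N : ℕ} {E : Finset (Fin N × Fin N)} {J : Fin N → Fin N → ℝ} {A : Finset (Fin N)}
  {E₀ : ℝ}

/-- The eigenvector condition. -/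
def Eig (E : Finset (Fin N × Fin N)) (J : Fin N → Fin N → ℝ) (E₀ : ℝ) (ψ : Cfg N → ℂ) : Prop :=
  Ham E J *ᵥ ψ = (E₀ : ℂ) • ψ

lemma Eig.tot (hE : ∀ p ∈ E, p.1 ≠ p.2) {ψ : Cfg N → ℂ} (h : Eig E J E₀ ψ)
    (a : Matrix (Fin 2) (Fin 2) ℂ) : Eig E J E₀ (MLM.tot a *ᵥ ψ) := by
  unfold Eig at *
  rw [Ham_tot J hE, h, Matrix.mulVec_smul]

lemma uniq (hzero : ∀ ψ, Eig E J E₀ ψ → ∀ σ τ : Cfg N, wt σ = wt τ → ψ σ = 0 → ψ τ = 0)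
    {k : ℕ} {ψ φ : Cfg N → ℂ} (hψ : Eig E J E₀ ψ) (hφ : Eig E J E₀ φ) (hψk : InSec k ψ)
    (hφk : InSec k φ) (h0 : φ ≠ 0) : ∃ c : ℂ, ψ = c • φ := by
  obtain ⟨σ, hσ⟩ : ∃ σ, φ σ ≠ 0 := by
    by_contra hc
    push Not at hc
    exact h0 (funext hc)
  refine ⟨ψ σ / φ σ, ?_⟩
  have hd : Eig E J E₀ (ψ - (ψ σ / φ σ) • φ) := by
    unfold Eig at *
    rw [Matrix.mulVec_sub, Matrix.mulVec_smul, hψ, hφ, smul_sub, smul_comm]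
  ext τ
  by_cases hτ : wt σ = wt τ
  · have := hzero _ hd σ τ hτ (by simp [hσ])
    rw [Pi.sub_apply, sub_eq_zero] at this
    exact this
  · have hk := hφk σ hσ
    have h1 : ψ τ = 0 := by
      by_contra hc
      exact hτ (by rw [hk, hψk τ hc])
    have h2 : φ τ = 0 := by
      by_contra hc
      exact hτ (by rw [hk, hφk τ hc])
    simp [h1, h2]

lemma kill (hE : ∀ p ∈ E, p.1 ≠ p.2)
    (hzero : ∀ ψ, Eig E J E₀ ψ → ∀ σ τ : Cfg N, wt σ = wt τ → ψ σ = 0 → ψ τ = 0)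
    (hmar : ∀ ψ, Eig E J E₀ ψ → Eig E J E₀ (mar A ψ))
    (hbal : A.card = Aᶜ.card) (hN : 0 < N)
    {ψ : Cfg N → ℂ} (hψ : Eig E J E₀ ψ) (hψk : InSec A.card ψ) :
    Rop *ᵥ ψ = 0 ∧ Lop *ᵥ ψ = 0 := by
  have hcard : A.card + A.card = N := by
    have := Finset.card_add_card_compl A
    rw [← hbal] at this
    simpa using this
  by_cases h0 : ψ = 0
  · simp [h0]
  obtain ⟨σ₀, hσ₀⟩ : ∃ σ, ψ σ ≠ 0 := by
    by_contra hc
    push Not at hc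
    exact h0 (funext hc)
  have hst : ψ (stag A) ≠ 0 := by
    intro hc
    exact hσ₀ (hzero _ hψ _ _ (by rw [wt_stag, hψk _ hσ₀]) hc)
  have hφ := hmar ψ hψ
  have hφk : InSec A.card (mar A ψ) := fun σ hσ => hψk σ (fun h => hσ ((mar_eq_zero A ψ σ).2 h))
  have hφ0 : mar A ψ ≠ 0 := fun h => hσ₀ ((mar_eq_zero A ψ σ₀).1 (congrFun h σ₀))
  obtain ⟨t, ht, htA⟩ := exists_pairing A hbal
  obtain ⟨m, hm⟩ : ∃ m, A.card = m + 1 := ⟨A.card - 1, by omega⟩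
  have hχ : Eig E J E₀ (Lop *ᵥ (Rop *ᵥ mar A ψ)) := (hφ.tot hE _).tot hE _
  have hχk : InSec A.card (Lop *ᵥ (Rop *ᵥ mar A ψ)) := by
    rw [hm] at hφk ⊢
    exact Lop_sec (Rop_sec hφk)
  obtain ⟨c, hc⟩ := uniq hzero hχ hφ hχk hφk hφ0
  have hR : Rop *ᵥ mar A ψ = 0 := by
    have h1 := adj_dot Lop (dim A t) (Rop *ᵥ mar A ψ)
    rw [Lop_conjTranspose, R_dim ht htA, star_zero, zero_dotProduct, hc, dotProduct_smul,
      smul_eq_mul] at h1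
    have hc0 : c = 0 := by
      rcases mul_eq_zero.1 h1 with h | h
      · exact h
      · exact absurd h (dim_mar_pos htA ψ hst)
    refine (ker_of_neg Rop (mar A ψ) 0 le_rfl ?_).1
    rw [Rop_conjTranspose, hc, hc0]; simp
  obtain ⟨b, hb⟩ := uniq hzero hψ hφ hψk hφk hφ0
  have hRψ : Rop *ᵥ ψ = 0 := by rw [hb, Matrix.mulVec_smul, hR, smul_zero]
  refine ⟨hRψ, (ker_of_neg Lop ψ 0 le_rfl ?_).1⟩
  rw [Lop_conjTranspose, RL_sec hψk, hRψ, Matrix.mulVec_zero, zero_add]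
  congr 2
  have hcard' : (A.card : ℝ) + A.card = N := by exact_mod_cast hcard
  linarith

lemma low (hE : ∀ p ∈ E, p.1 ≠ p.2) {m : ℕ} (hm : m + m = N)
    (hk : ∀ ψ : Cfg N → ℂ, Eig E J E₀ ψ → InSec m ψ → Rop *ᵥ ψ = 0 ∧ Lop *ᵥ ψ = 0)
    (j k : ℕ) (hj : k + j + 1 = m) (ψ : Cfg N → ℂ) (hψ : Eig E J E₀ ψ) (hψk : InSec k ψ) :
    ψ = 0 := by
  induction j generalizing k ψ with
  | zero =>
    have h1 := (hk _ (hψ.tot hE _) (hj ▸ Lop_sec hψk)).1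
    have h2 := RL_sec hψk
    refine (ker_of_neg Rop ψ (-(N - 2 * k : ℝ)) ?_ ?_).2 ?_
    · rw [← hm, ← hj]; push_cast; linarith
    · have h1' : Rop *ᵥ (Lop *ᵥ ψ) = 0 := h1
      rw [h1'] at h2
      rw [Rop_conjTranspose, Complex.ofReal_neg, neg_smul]
      exact eq_neg_of_add_eq_zero_left h2.symm
    · rw [← hm, ← hj]; push_cast; linarith
  | succ j ih =>
    have h1 : Lop *ᵥ ψ = 0 := ih (k + 1) (by omega) _ (hψ.tot hE _) (Lop_sec hψk)
    have h2 := RL_sec hψk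
    have hj' : (k : ℝ) + (j + 1) + 1 = m := by exact_mod_cast hj
    have hm' : (m : ℝ) + m = N := by exact_mod_cast hm
    have hjn : (0 : ℝ) ≤ j := Nat.cast_nonneg j
    refine (ker_of_neg Rop ψ (-(N - 2 * k : ℝ)) ?_ ?_).2 ?_
    · linarith
    · rw [h1, Matrix.mulVec_zero] at h2
      rw [Rop_conjTranspose, Complex.ofReal_neg, neg_smul]
      exact eq_neg_of_add_eq_zero_left h2.symm
    · linarith

lemma high (hE : ∀ p ∈ E, p.1 ≠ p.2) {m : ℕ} (hm : m + m = N)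
    (hk : ∀ ψ : Cfg N → ℂ, Eig E J E₀ ψ → InSec m ψ → Rop *ᵥ ψ = 0 ∧ Lop *ᵥ ψ = 0)
    (j : ℕ) (ψ : Cfg N → ℂ) (hψ : Eig E J E₀ ψ) (hψk : InSec (m + j + 1) ψ) :
    ψ = 0 := by
  have key : Lop *ᵥ (Rop *ᵥ ψ) = 0 → ψ = 0 := by
    intro h1
    have h2 := RL_sec hψk
    have hm' : (m : ℝ) + m = N := by exact_mod_cast hm
    have hjn : (0 : ℝ) ≤ j := Nat.cast_nonneg j
    refine (ker_of_neg Lop ψ (N - 2 * ((m + j + 1 : ℕ) : ℝ)) ?_ ?_).2 ?_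
    · push_cast; linarith
    · rw [h1, zero_add] at h2
      rw [Lop_conjTranspose]
      exact h2
    · push_cast; linarith
  apply key
  induction j generalizing ψ with
  | zero => exact (hk _ (hψ.tot hE _) (Rop_sec hψk)).2
  | succ j ih =>
    have hR : Eig E J E₀ (Rop *ᵥ ψ) := hψ.tot hE _
    have hRk : InSec (m + j + 1) (Rop *ᵥ ψ) := Rop_sec (k := m + j + 1) hψk
    have : Rop *ᵥ ψ = 0 := by
      have key' : Lop *ᵥ (Rop *ᵥ (Rop *ᵥ ψ)) = 0 → Rop *ᵥ ψ = 0 := by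
        intro h1
        have h2 := RL_sec hRk
        have hm' : (m : ℝ) + m = N := by exact_mod_cast hm
        have hjn : (0 : ℝ) ≤ j := Nat.cast_nonneg j
        refine (ker_of_neg Lop _ (N - 2 * ((m + j + 1 : ℕ) : ℝ)) ?_ ?_).2 ?_
        · push_cast; linarith
        · rw [h1, zero_add] at h2
          rw [Lop_conjTranspose]
          exact h2
        · push_cast; linarith
      exact key' (ih _ hR hRk key')
    rw [this, Matrix.mulVec_zero]

lemma all_sec (hE : ∀ p ∈ E, p.1 ≠ p.2) {m : ℕ} (hm : m + m = N)
    (hk : ∀ ψ : Cfg N → ℂ, Eig E J E₀ ψ → InSec m ψ → Rop *ᵥ ψ = 0 ∧ Lop *ᵥ ψ = 0)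
    (ψ : Cfg N → ℂ) (hψ : Eig E J E₀ ψ) : InSec m ψ := by
  intro σ hσ
  have h1 : Eig E J E₀ (proj (wt σ) ψ) := by
    unfold Eig at *
    rw [Ham_proj J hE, hψ]
    ext τ
    simp [proj]
  have h2 := proj_sec (wt σ) ψ
  have h3 : proj (wt σ) ψ ≠ 0 := by
    intro h
    have := congrFun h σ
    simp [proj] at this
    exact hσ this
  rcases lt_trichotomy (wt σ) m with h | h | h
  · exact absurd (low hE hm hk (m - wt σ - 1) (wt σ) (by omega) _ h1 h2) h3
  · exact h
  · refine absurd (high hE hm hk (wt σ - m - 1) _ h1 ?_) h3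
    have : m + (wt σ - m - 1) + 1 = wt σ := by omega
    rw [this]; exact h2

lemma sz_zero {m : ℕ} (hm : m + m = N) {ψ : Cfg N → ℂ} (h : InSec m ψ) :
    tot !![1, 0; 0, -1] *ᵥ ψ = 0 := by
  ext σ
  rw [tot_z]
  by_cases h0 : ψ σ = 0
  · simp [h0]
  · have hm' : (m : ℂ) + m = N := by exact_mod_cast hm
    rw [h σ h0, Pi.zero_apply]
    linear_combination (- ψ σ) * hm'

lemma tot_add (a b : Matrix (Fin 2) (Fin 2) ℂ) :
    (tot (a + b) : Matrix (Cfg N) (Cfg N) ℂ) = tot a + tot b := by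
  simp [tot, emb_add, Finset.sum_add_distrib]

lemma tot_smul (c : ℂ) (a : Matrix (Fin 2) (Fin 2) ℂ) :
    (tot (c • a) : Matrix (Cfg N) (Cfg N) ℂ) = c • tot a := by
  simp [tot, emb_smul, Finset.smul_sum]

lemma spin_zero {ψ : Cfg N → ℂ} (hR : Rop *ᵥ ψ = 0) (hL : Lop *ᵥ ψ = 0)
    (hZ : tot !![1, 0; 0, -1] *ᵥ ψ = 0) :
    (∑ α : Fin 3, (∑ i : Fin N, spinOp i α) ^ 2).mulVec ψ = 0 := by
  rw [Matrix.sum_mulVec]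
  refine Finset.sum_eq_zero fun α _ => ?_
  have h1 : (∑ i : Fin N, spinOp i α) = tot ((1 / 2 : ℂ) • pauli α) := by
    simp [tot, spinOp_eq]
  have hx : pauli 0 = !![0, 1; 0, 0] + !![0, 0; 1, 0] := by
    ext i j; fin_cases i <;> fin_cases j <;> simp [pauli]
  have hy : pauli 1 = (-Complex.I) • !![0, 1; 0, 0] + Complex.I • !![0, 0; 1, 0] := by
    ext i j; fin_cases i <;> fin_cases j <;> simp [pauli]
  have hz : pauli 2 = !![1, 0; 0, -1] := rfl
  have hR' : tot !![0, 1; 0, 0] *ᵥ ψ = 0 := hR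
  have hL' : tot !![0, 0; 1, 0] *ᵥ ψ = 0 := hL
  have h2 : (∑ i : Fin N, spinOp i α) *ᵥ ψ = 0 := by
    rw [h1, tot_smul, Matrix.smul_mulVec]
    have h3 : tot (pauli α) *ᵥ ψ = 0 := by
      fin_cases α
      · change tot (pauli 0) *ᵥ ψ = 0
        rw [hx, tot_add, Matrix.add_mulVec, hR', hL', add_zero]
      · change tot (pauli 1) *ᵥ ψ = 0
        rw [hy, tot_add, tot_smul, tot_smul, Matrix.add_mulVec, Matrix.smul_mulVec,
          Matrix.smul_mulVec, hR', hL']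
        simp
      · change tot (pauli 2) *ᵥ ψ = 0
        rw [hz, hZ]
    rw [h3, smul_zero]
  rw [sq, ← Matrix.mulVec_mulVec, h2, Matrix.mulVec_zero]

lemma exists_min_spec (H : Matrix (Cfg N) (Cfg N) ℂ) (hH : H.IsHermitian) :
    ∃ E₀ : ℝ, (E₀ : ℂ) ∈ spectrum ℂ H ∧ (∀ μ ∈ spectrum ℂ H, E₀ ≤ μ.re) ∧
      (H - (E₀ : ℂ) • (1 : Matrix (Cfg N) (Cfg N) ℂ)).PosSemidef := by
  have hs := hH.spectrum_eq_image_range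
  obtain ⟨i, hi⟩ := Finite.exists_min hH.eigenvalues
  have hmin : ∀ μ ∈ spectrum ℂ H, ∃ r : ℝ, μ = r ∧ hH.eigenvalues i ≤ r := by
    intro μ hμ
    rw [hs] at hμ
    obtain ⟨_, ⟨j, rfl⟩, rfl⟩ := hμ
    exact ⟨_, rfl, hi j⟩
  refine ⟨hH.eigenvalues i, ?_, ?_, ?_⟩
  · rw [hs]; exact ⟨_, ⟨i, rfl⟩, rfl⟩
  · intro μ hμ
    obtain ⟨r, rfl, hr⟩ := hmin μ hμ
    simpa using hr
  · rw [Matrix.posSemidef_iff_isHermitian_and_spectrum_nonneg]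
    constructor
    · apply hH.sub
      rw [Matrix.IsHermitian, Matrix.conjTranspose_smul]
      simp
    · intro x hx
      rw [← Algebra.algebraMap_eq_smul_one, ← spectrum.sub_singleton_eq] at hx
      obtain ⟨μ, hμ, y, hy, rfl⟩ := hx
      obtain ⟨r, rfl, hr⟩ := hmin μ hμ
      rw [Set.mem_singleton_iff] at hy
      subst hy
      simp only [Set.mem_ofPred_eq, sub_nonneg]
      exact_mod_cast hr

end main

end MLM
/-- **Marshall–Lieb–Mattis theorem** (spin-1/2 case).  For the
antiferromagnetic Heisenberg Hamiltonian `H = Σ_{{i,j}∈E} J_{ij} S_i·S_j`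
(`J_{ij} > 0` on edges) on a finite connected bipartite graph whose two
parts have equal size, the minimum eigenvalue is nondegenerate and the
ground state has total spin zero, i.e. it is annihilated by
`S²_tot = Σ_α (Σ_i S_i^α)²`. -/
theorem marshall_lieb_mattis {N : ℕ} (G : SimpleGraph (Fin N))
    [DecidableRel G.Adj] (hconn : G.Connected)
    (A : Finset (Fin N)) (hbip : ∀ i j, G.Adj i j → (i ∈ A ↔ j ∉ A))
    (hbalanced : A.card = Aᶜ.card)
    (J : Fin N → Fin N → ℝ) (hsymm : ∀ i j, J i j = J j i)
    (hpos : ∀ i j, G.Adj i j → 0 < J i j) :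
    ∃ E₀ : ℝ,
      (E₀ : ℂ) ∈ spectrum ℂ
        (∑ p ∈ Finset.univ.filter
            (fun p : Fin N × Fin N => p.1 < p.2 ∧ G.Adj p.1 p.2),
          (J p.1 p.2 : ℂ) • heis p.1 p.2) ∧
      (∀ μ ∈ spectrum ℂ
          (∑ p ∈ Finset.univ.filter
              (fun p : Fin N × Fin N => p.1 < p.2 ∧ G.Adj p.1 p.2),
            (J p.1 p.2 : ℂ) • heis p.1 p.2), E₀ ≤ μ.re) ∧
      Module.finrank ℂ
        (Module.End.eigenspace
          (Matrix.mulVecLin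
            (∑ p ∈ Finset.univ.filter
                (fun p : Fin N × Fin N => p.1 < p.2 ∧ G.Adj p.1 p.2),
              (J p.1 p.2 : ℂ) • heis p.1 p.2)) (E₀ : ℂ)) = 1 ∧
      ∀ ψ ∈ Module.End.eigenspace
          (Matrix.mulVecLin
            (∑ p ∈ Finset.univ.filter
                (fun p : Fin N × Fin N => p.1 < p.2 ∧ G.Adj p.1 p.2),
              (J p.1 p.2 : ℂ) • heis p.1 p.2)) (E₀ : ℂ),
        (∑ α : Fin 3, (∑ i : Fin N, spinOp i α) ^ 2).mulVec ψ = 0 := by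
  have hE : ∀ p ∈ Finset.univ.filter
      (fun p : Fin N × Fin N => p.1 < p.2 ∧ G.Adj p.1 p.2), p.1 ≠ p.2 := by
    intro p hp
    exact (Finset.mem_filter.1 hp).2.1.ne
  have hA : ∀ p ∈ Finset.univ.filter
      (fun p : Fin N × Fin N => p.1 < p.2 ∧ G.Adj p.1 p.2), (p.1 ∈ A ↔ p.2 ∉ A) := by
    intro p hp
    exact hbip _ _ (Finset.mem_filter.1 hp).2.2
  have hJ : ∀ p ∈ Finset.univ.filter
      (fun p : Fin N × Fin N => p.1 < p.2 ∧ G.Adj p.1 p.2), 0 < J p.1 p.2 := by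
    intro p hp
    exact hpos _ _ (Finset.mem_filter.1 hp).2.2
  have hEG : ∀ i j, G.Adj i j → i < j → (i, j) ∈ Finset.univ.filter
      (fun p : Fin N × Fin N => p.1 < p.2 ∧ G.Adj p.1 p.2) := by
    intro i j h hij
    simp [h, hij]
  generalize Finset.univ.filter
      (fun p : Fin N × Fin N => p.1 < p.2 ∧ G.Adj p.1 p.2) = E at *
  change ∃ E₀ : ℝ, (E₀ : ℂ) ∈ spectrum ℂ (MLM.Ham E J) ∧
    (∀ μ ∈ spectrum ℂ (MLM.Ham E J), E₀ ≤ μ.re) ∧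
    Module.finrank ℂ (Module.End.eigenspace (Matrix.mulVecLin (MLM.Ham E J)) (E₀ : ℂ)) = 1 ∧
    ∀ ψ ∈ Module.End.eigenspace (Matrix.mulVecLin (MLM.Ham E J)) (E₀ : ℂ),
      (∑ α : Fin 3, (∑ i : Fin N, spinOp i α) ^ 2).mulVec ψ = 0
  obtain ⟨E₀, hspec, hmin, hpsd⟩ := MLM.exists_min_spec _ (MLM.Ham_herm J hE)
  have hmem : ∀ ψ, ψ ∈ Module.End.eigenspace (Matrix.mulVecLin (MLM.Ham E J)) (E₀ : ℂ) ↔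
      MLM.Eig E J E₀ ψ := by
    intro ψ
    rw [Module.End.mem_eigenspace_iff, Matrix.mulVecLin_apply]
    rfl
  have hN : 0 < N := Fin.pos_iff_nonempty.2 hconn.nonempty
  have hzero : ∀ ψ, MLM.Eig E J E₀ ψ → ∀ σ τ : MLM.Cfg N, MLM.wt σ = MLM.wt τ →
      ψ σ = 0 → ψ τ = 0 := by
    intro ψ hψ σ τ hst h0
    obtain ⟨π, rfl⟩ := MLM.exists_perm σ τ hst
    refine MLM.zero_perm G hconn ψ ?_ π σ h0
    intro i j hij ρ hρ
    rcases lt_trichotomy i j with h | h | h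
    · exact MLM.zero_step hE hA hJ hpsd ψ hψ ρ hρ (i, j) (hEG i j hij h)
    · exact absurd h hij.ne
    · rw [Equiv.swap_comm]
      exact MLM.zero_step hE hA hJ hpsd ψ hψ ρ hρ (j, i) (hEG j i hij.symm h)
  have hmar : ∀ ψ, MLM.Eig E J E₀ ψ → MLM.Eig E J E₀ (MLM.mar A ψ) :=
    fun ψ hψ => MLM.mar_eig hE hA hJ hpsd ψ hψ
  have hkill : ∀ ψ : MLM.Cfg N → ℂ, MLM.Eig E J E₀ ψ → MLM.InSec A.card ψ →
      MLM.Rop *ᵥ ψ = 0 ∧ MLM.Lop *ᵥ ψ = 0 :=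
    fun ψ hψ hk => MLM.kill hE hzero hmar hbalanced hN hψ hk
  have hcard : A.card + A.card = N := by
    have := Finset.card_add_card_compl A
    rw [← hbalanced] at this
    simpa using this
  have hsec := MLM.all_sec hE hcard hkill
  refine ⟨E₀, hspec, hmin, ?_, ?_⟩
  · have hev : Module.End.HasEigenvalue (Matrix.mulVecLin (MLM.Ham E J)) (E₀ : ℂ) := by
      rw [Module.End.hasEigenvalue_iff_mem_spectrum, ← Matrix.toLin'_apply',
        Matrix.spectrum_toLin']
      exact hspec
    obtain ⟨v, hv⟩ := hev.exists_hasEigenvector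
    rw [finrank_eq_one_iff']
    refine ⟨⟨v, hv.1⟩, fun h => hv.2 (congrArg Subtype.val h), ?_⟩
    rintro ⟨w, hw⟩
    have hv' := (hmem v).1 hv.1
    have hw' := (hmem w).1 hw
    obtain ⟨c, hc⟩ := MLM.uniq hzero hw' hv' (hsec w hw') (hsec v hv') hv.2
    exact ⟨c, Subtype.ext hc.symm⟩
  · intro ψ hψ
    have hψ' := (hmem ψ).1 hψ
    have hk := hsec ψ hψ'
    exact MLM.spin_zero (hkill ψ hψ' hk).1 (hkill ψ hψ' hk).2 (MLM.sz_zero hcard hk)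
end

section
/- Let H be an n×n Hermitian complex matrix with minimum eigenvalue E₀ and let ψ₀ be a unit eigenvector of H with Hψ₀ = E₀ψ₀. Then for any n×n complex matrix A, the ground-state expectation of the double commutator satisfies ⟨ψ₀, [A†, [H, A]] ψ₀⟩ = ⟨Aψ₀, (H - E₀·I) Aψ₀⟩ + ⟨A†ψ₀, (H - E₀·I) A†ψ₀⟩, and in particular ⟨ψ₀, [A†, [H, A]] ψ₀⟩ is real and nonnegative. -/
open Matrix

/-- For a Hermitian matrix `H` with minimum eigenvalue `E₀` and unit ground
state `ψ₀`, and any matrix `A`, the ground-state expectation of the double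
commutator `[A†, [H, A]]` equals
`⟨Aψ₀, (H - E₀)Aψ₀⟩ + ⟨A†ψ₀, (H - E₀)A†ψ₀⟩`; in particular it is real and
nonnegative. -/
theorem double_commutator_expectation {n : ℕ} (H : Matrix (Fin n) (Fin n) ℂ)
    (hH : H.IsHermitian) (E₀ : ℝ) (ψ₀ : Fin n → ℂ)
    (hunit : star ψ₀ ⬝ᵥ ψ₀ = 1)
    (heig : H.mulVec ψ₀ = (E₀ : ℂ) • ψ₀)
    (hmin : ∀ μ ∈ spectrum ℂ H, E₀ ≤ μ.re)
    (A : Matrix (Fin n) (Fin n) ℂ) :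
    star ψ₀ ⬝ᵥ (Aᴴ * (H * A - A * H) - (H * A - A * H) * Aᴴ).mulVec ψ₀ =
      star (A.mulVec ψ₀) ⬝ᵥ ((H - (E₀ : ℂ) • 1).mulVec (A.mulVec ψ₀)) +
        star (Aᴴ.mulVec ψ₀) ⬝ᵥ ((H - (E₀ : ℂ) • 1).mulVec (Aᴴ.mulVec ψ₀)) ∧
    ∃ r : ℝ, 0 ≤ r ∧
      star ψ₀ ⬝ᵥ (Aᴴ * (H * A - A * H) - (H * A - A * H) * Aᴴ).mulVec ψ₀
        = (r : ℂ) := by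
  have hψ : star ψ₀ ᵥ* H = (E₀ : ℂ) • star ψ₀ := by
    have h := congrArg star heig
    rw [star_mulVec, hH.eq, star_smul] at h
    simpa using h
  have key : star ψ₀ ⬝ᵥ (Aᴴ * (H * A - A * H) - (H * A - A * H) * Aᴴ).mulVec ψ₀ =
      star (A.mulVec ψ₀) ⬝ᵥ ((H - (E₀ : ℂ) • 1).mulVec (A.mulVec ψ₀)) +
        star (Aᴴ.mulVec ψ₀) ⬝ᵥ ((H - (E₀ : ℂ) • 1).mulVec (Aᴴ.mulVec ψ₀)) := by
    have h1 : star ψ₀ ⬝ᵥ H *ᵥ (A *ᵥ (Aᴴ *ᵥ ψ₀)) =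
        (E₀ : ℂ) * (star ψ₀ ⬝ᵥ A *ᵥ (Aᴴ *ᵥ ψ₀)) := by
      rw [dotProduct_mulVec, hψ, smul_dotProduct, smul_eq_mul]
    simp only [star_mulVec, conjTranspose_conjTranspose, ← dotProduct_mulVec, sub_mulVec,
      mul_sub, sub_mul, ← mulVec_mulVec, heig, mulVec_smul, mulVec_sub, dotProduct_sub,
      dotProduct_smul, smul_mulVec, one_mulVec, smul_eq_mul, h1]
    ring
  have hherm : (H - (E₀ : ℂ) • 1).IsHermitian := by
    apply hH.sub
    simp [IsHermitian, conjTranspose_smul]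
  refine ⟨key, ?_⟩
  rw [key]
  open scoped ComplexOrder in
  (
    have hpsd : (H - (E₀ : ℂ) • 1).PosSemidef := by
      rw [hherm.posSemidef_iff_eigenvalues_nonneg]
      intro i
      have hm : ((hherm.eigenvalues i : ℝ) : ℂ) ∈ spectrum ℂ (H - (E₀ : ℂ) • 1) := by
        rw [hherm.spectrum_eq_image_range]
        exact ⟨_, ⟨i, rfl⟩, rfl⟩
      have hm2 : ((hherm.eigenvalues i : ℝ) : ℂ) + (E₀ : ℂ) ∈ spectrum ℂ H := by
        rw [spectrum.mem_iff] at hm ⊢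
        convert hm using 2
        rw [map_add, Algebra.algebraMap_eq_smul_one (E₀ : ℂ)]
        abel
      have h := hmin _ hm2
      simp at h
      simpa using h
    have h := add_nonneg (hpsd.dotProduct_mulVec_nonneg (A *ᵥ ψ₀))
      (hpsd.dotProduct_mulVec_nonneg (Aᴴ *ᵥ ψ₀))
    obtain ⟨h1, h2⟩ := Complex.nonneg_iff.mp h
    exact ⟨_, h1, Complex.ext (by simp) (by simpa using h2.symm)⟩)
end

section
/- (Single-mode variational bound.) Let H be an n×n Hermitian complex matrix with minimum eigenvalue E₀ and unit ground state ψ₀ (Hψ₀ = E₀ψ₀), and let A be any n×n complex matrix with Aψ₀ ≠ 0. Then the variational energy of the state Aψ₀ above the ground state energy satisfies 0 ≤ ⟨Aψ₀, (H - E₀·I) Aψ₀⟩ ≤ ⟨ψ₀, [A†, [H, A]] ψ₀⟩. Consequently, the excitation energy of the normalized variational state Aψ₀/‖Aψ₀‖ is at most ⟨ψ₀, [A†, [H, A]] ψ₀⟩ / ‖Aψ₀‖². -/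
open Matrix
open scoped ComplexOrder

/-- **Single-mode variational bound.**  For a Hermitian matrix `H` with
minimum eigenvalue `E₀` and unit ground state `ψ₀`, and any matrix `A` with
`Aψ₀ ≠ 0`, the variational energy of `Aψ₀` above the ground state satisfies
`0 ≤ ⟨Aψ₀, (H - E₀)Aψ₀⟩ ≤ ⟨ψ₀, [A†, [H, A]]ψ₀⟩`; consequently the
excitation energy of the normalized state `Aψ₀/‖Aψ₀‖` is at most
`⟨ψ₀, [A†, [H, A]]ψ₀⟩ / ‖Aψ₀‖²`. -/
theorem single_mode_variational_bound {n : ℕ} (H : Matrix (Fin n) (Fin n) ℂ)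
    (hH : H.IsHermitian) (E₀ : ℝ) (ψ₀ : Fin n → ℂ)
    (hunit : star ψ₀ ⬝ᵥ ψ₀ = 1)
    (heig : H.mulVec ψ₀ = (E₀ : ℂ) • ψ₀)
    (hmin : ∀ μ ∈ spectrum ℂ H, E₀ ≤ μ.re)
    (A : Matrix (Fin n) (Fin n) ℂ) (hA : A.mulVec ψ₀ ≠ 0) :
    ∃ r s : ℝ,
      star (A.mulVec ψ₀) ⬝ᵥ ((H - (E₀ : ℂ) • 1).mulVec (A.mulVec ψ₀))
          = (r : ℂ) ∧
      star ψ₀ ⬝ᵥ (Aᴴ * (H * A - A * H) - (H * A - A * H) * Aᴴ).mulVec ψ₀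
          = (s : ℂ) ∧
      0 ≤ r ∧ r ≤ s ∧
      r / (star (A.mulVec ψ₀) ⬝ᵥ A.mulVec ψ₀).re ≤
        s / (star (A.mulVec ψ₀) ⬝ᵥ A.mulVec ψ₀).re := by
  set M : Matrix (Fin n) (Fin n) ℂ := H - (E₀ : ℂ) • 1 with hMdef
  have hMH : M.IsHermitian := by
    unfold Matrix.IsHermitian
    rw [hMdef, conjTranspose_sub, conjTranspose_smul, conjTranspose_one, hH.eq]
    simp
  have hM : M.PosSemidef := by
    rw [hMH.posSemidef_iff_eigenvalues_nonneg]
    intro i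
    have h1 : ((hMH.eigenvalues i : ℝ) : ℂ) ∈ spectrum ℂ M := by
      rw [hMH.spectrum_eq_image_range]
      exact ⟨_, ⟨i, rfl⟩, rfl⟩
    have h2 : ((hMH.eigenvalues i : ℝ) : ℂ) + (E₀ : ℂ) ∈ spectrum ℂ H := by
      rw [spectrum.add_mem_iff]
      have : -(algebraMap ℂ (Matrix (Fin n) (Fin n) ℂ)) (E₀ : ℂ) + H = M := by
        rw [hMdef, Algebra.algebraMap_eq_smul_one]; abel
      rw [this]; exact h1
    have h3 := hmin _ h2
    simp at h3
    simpa using h3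
  have hMψ : M.mulVec ψ₀ = 0 := by
    rw [hMdef, sub_mulVec, heig, smul_mulVec, one_mulVec, sub_self]
  have hψM : star ψ₀ ᵥ* M = 0 := by
    have h := star_mulVec M ψ₀
    rw [hMψ, hMH.eq] at h
    simpa using h.symm
  have hcomm : Aᴴ * (H * A - A * H) - (H * A - A * H) * Aᴴ
      = Aᴴ * M * A - Aᴴ * A * M - M * A * Aᴴ + A * M * Aᴴ := by
    have : H * A - A * H = M * A - A * M := by
      rw [hMdef]; simp [sub_mul, mul_sub]
    rw [this]; noncomm_ring
  have hA1 := hM.dotProduct_mulVec_nonneg (A.mulVec ψ₀)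
  have hA2 := hM.dotProduct_mulVec_nonneg (Aᴴ.mulVec ψ₀)
  have key : star ψ₀ ⬝ᵥ (Aᴴ * (H * A - A * H) - (H * A - A * H) * Aᴴ).mulVec ψ₀
      = star (A.mulVec ψ₀) ⬝ᵥ (M.mulVec (A.mulVec ψ₀))
        + star (Aᴴ.mulVec ψ₀) ⬝ᵥ (M.mulVec (Aᴴ.mulVec ψ₀)) := by
    have e1 : star ψ₀ ⬝ᵥ (M * A * Aᴴ).mulVec ψ₀ = 0 := by
      rw [Matrix.mul_assoc, ← mulVec_mulVec, dotProduct_mulVec, hψM, zero_dotProduct]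
    have e2 : (Aᴴ * A * M).mulVec ψ₀ = 0 := by
      rw [← mulVec_mulVec, hMψ, mulVec_zero]
    rw [hcomm, add_mulVec, sub_mulVec, sub_mulVec, e2, dotProduct_add, dotProduct_sub, e1]
    simp [star_mulVec, dotProduct_mulVec, vecMul_vecMul, Matrix.mul_assoc]
  rw [Complex.nonneg_iff] at hA1 hA2
  have hle : (star (A.mulVec ψ₀) ⬝ᵥ (M.mulVec (A.mulVec ψ₀))).re ≤
      (star (A.mulVec ψ₀) ⬝ᵥ (M.mulVec (A.mulVec ψ₀))).re
        + (star (Aᴴ.mulVec ψ₀) ⬝ᵥ (M.mulVec (Aᴴ.mulVec ψ₀))).re := by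
    linarith [hA2.1]
  refine ⟨_, _, Complex.ext rfl ?_, key.trans (Complex.ext (Complex.add_re _ _) ?_),
    hA1.1, hle, ?_⟩
  · rw [← hA1.2]; rfl
  · rw [Complex.add_im, ← hA1.2, ← hA2.2, add_zero]; rfl
  · apply div_le_div_of_nonneg_right hle
    exact (Complex.nonneg_iff.mp (dotProduct_star_self_nonneg _)).1
end
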